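/- Let P ⊂ ℝ⁵ be a 5-dimensional reflexive polytope, and suppose L_P has a root −1/2 + a + bi ∈ ℂ with a ≠ 0 and b ≠ 0. Then |a| < 3/2; consequently every root z of L_P satisfies −5/2 ≤ Re z ≤ 3/2. -/

import Mathlib

open Pointwise MeasureTheory Polynomial

noncomputable section

/-- The lattice points of a subset `S ⊆ ℝ^d`: integer vectors whose real cast lies in `S`. -/
def latticePts (d : ℕ) (S : Set (Fin d → ℝ)) : Set (Fin d → ℤ) :=
  {x | (fun i => (x i : ℝ)) ∈ S}

/-- `P ⊆ ℝ^d` is a lattice polytope: the convex hull of finitely many integer points. -/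
def IsLatticePolytope (d : ℕ) (P : Set (Fin d → ℝ)) : Prop :=
  ∃ V : Finset (Fin d → ℤ),
    P = convexHull ℝ ((fun v : Fin d → ℤ => fun i => (v i : ℝ)) '' (V : Set (Fin d → ℤ)))

/-- `P` is full-dimensional in `ℝ^d`. -/
def IsFullDim (d : ℕ) (P : Set (Fin d → ℝ)) : Prop :=
  affineSpan ℝ P = ⊤

/-- `L` is the Ehrhart polynomial of `P`: `L(m) = |mP ∩ ℤ^d|` for every natural number `m`. -/
def IsEhrhart (d : ℕ) (P : Set (Fin d → ℝ)) (L : Polynomial ℚ) : Prop :=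
  ∀ m : ℕ, L.eval (m : ℚ) = ((latticePts d ((m : ℝ) • P)).ncard : ℚ)

/-- The complex roots of a rational polynomial, counted with multiplicity. -/
def cRoots (L : Polynomial ℚ) : Multiset ℂ :=
  (L.map (algebraMap ℚ ℂ)).roots

/-- `L` is a CL-polynomial: every complex root has real part `-1/2`. -/
def IsCL (L : Polynomial ℚ) : Prop :=
  ∀ z ∈ cRoots L, z.re = -(1/2 : ℝ)

/-- `L` has only real roots: every complex root has imaginary part `0`. -/
def IsRealRooted (L : Polynomial ℚ) : Prop :=
  ∀ z ∈ cRoots L, z.im = 0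

/-- The dual (polar) body `{u : ⟨u,v⟩ ≥ -1 for all v ∈ P}`. -/
def dualBody (d : ℕ) (P : Set (Fin d → ℝ)) : Set (Fin d → ℝ) :=
  {u | ∀ v ∈ P, -1 ≤ ∑ i, u i * v i}

/-- `P` is reflexive: the origin is interior and the dual body is a lattice polytope. -/
def IsReflexive (d : ℕ) (P : Set (Fin d → ℝ)) : Prop :=
  (0 : Fin d → ℝ) ∈ interior P ∧ IsLatticePolytope d (dualBody d P)

/-- The Euclidean volume of `P ⊆ ℝ^d`. -/
def vol (d : ℕ) (P : Set (Fin d → ℝ)) : ℝ :=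
  (volume P).toReal

/-- `δ` is the δ-vector of the Ehrhart polynomial `L` in dimension `d`:
`L(m) = ∑_{j=0}^d δ_j C(d+m-j, d)` for all natural numbers `m`. -/
def HasDeltaVector (d : ℕ) (L : Polynomial ℚ) (δ : Fin (d+1) → ℤ) : Prop :=
  ∀ m : ℕ, L.eval (m : ℚ) = ∑ j : Fin (d+1), (δ j : ℚ) * (Nat.choose (d + m - (j : ℕ)) d : ℚ)

/-- The discriminant `B²C² − 4AC³ − 4B³D − 27A²D² + 18ABCD` of the cubic `Az³+Bz²+Cz+D`. -/
def cubicDisc (A B C D : ℚ) : ℚ :=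
  B^2*C^2 - 4*A*C^3 - 4*B^3*D - 27*A^2*D^2 + 18*A*B*C*D

/-- The polynomial `(X + 1) ⋯ (X + d) / d!`, whose value at `k` is `C(k + d, d)`. -/
def simplexPoly (d : ℕ) : ℚ[X] :=
  C ((d.factorial : ℚ)⁻¹) * (descPochhammer ℚ d).comp (X + C (d : ℚ))

lemma simplexPoly_eval (d : ℕ) (x : ℚ) :
    (simplexPoly d).eval x = (d.factorial : ℚ)⁻¹ * (descPochhammer ℚ d).eval (x + d) := by
  simp [simplexPoly]

lemma natDegree_simplexPoly_le (d : ℕ) : (simplexPoly d).natDegree ≤ d := by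
  refine (natDegree_C_mul_le _ _).trans (natDegree_comp_le.trans ?_)
  rw [natDegree_X_add_C, mul_one, descPochhammer_natDegree]

lemma simplexPoly_eval_reflect (d : ℕ) (x : ℚ) :
    (simplexPoly d).eval (-(d + 1) - x) = (-1) ^ d * (simplexPoly d).eval x := by
  rw [simplexPoly_eval, simplexPoly_eval, descPochhammer_eval_eq_ascPochhammer ℚ (x + d),
    show x + (d : ℚ) - d + 1 = -(-(d + 1) - x + d) by ring,
    ascPochhammer_eval_neg_eq_descPochhammer, mul_left_comm, ← mul_assoc ((-1 : ℚ) ^ d),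
    ← mul_pow]
  simp

/-- The number of `n : ι → ℕ` with given sum is a polynomial in the sum. -/
lemma ncard_sum_eq_simplexPoly {ι : Type*} [Fintype ι] {d : ℕ} (hι : Fintype.card ι = d + 1)
    {k : ℤ} (hk : -d ≤ k) :
    ({n : ι → ℕ | ((∑ i, n i : ℕ) : ℤ) = k}.ncard : ℚ) = (simplexPoly d).eval (k : ℚ) := by
  classical
  obtain ⟨j, hj⟩ : ∃ j : ℕ, k + d = j := ⟨(k + d).toNat, by omega⟩
  have hjq : (k : ℚ) + d = j := by exact_mod_cast hj
  rw [simplexPoly_eval, hjq, descPochhammer_eval_eq_descFactorial]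
  by_cases hjd : j < d
  · rw [Nat.descFactorial_eq_zero_iff_lt.mpr hjd]
    have : {n : ι → ℕ | ((∑ i, n i : ℕ) : ℤ) = k} = ∅ := by
      ext n
      simp only [Set.mem_ofPred_eq, Set.mem_empty_iff_false, iff_false]
      omega
    rw [this]
    simp
  · obtain ⟨l, rfl⟩ : ∃ l : ℕ, j = l + d := ⟨j - d, by omega⟩
    obtain rfl : k = l := by push_cast at hj; omega
    have hset : {n : ι → ℕ | ((∑ i, n i : ℕ) : ℤ) = (l : ℤ)} = {n : ι → ℕ | ∑ i, n i = l} := by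
      ext n
      simp only [Set.mem_ofPred_eq, Nat.cast_inj]
    rw [hset]
    have hcard : {n : ι → ℕ | ∑ i, n i = l}.ncard = (l + d).choose d := by
      rw [← Nat.card_coe_set_eq]
      refine (Nat.card_congr (Sym.equivNatSumOfFintype ι l).symm).trans ?_
      rw [Nat.card_eq_fintype_card, Sym.card_sym_eq_choose, hι,
        show d + 1 + l - 1 = l + d by omega, Nat.choose_symm_add]
    rw [hcard, Nat.descFactorial_eq_factorial_mul_choose]
    have := Nat.factorial_ne_zero d
    push_cast
    field_simp

section HalfOpen

variable {ι Z E : Type*} [AddCommGroup Z] [AddCommGroup E] [Module ℝ E]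

/-- The points of `Z` in the simplicial cone over `b`, with the facets indexed by `S` removed. -/
def halfOpenCone (c : Z →+ E) (b : Module.Basis ι ℝ E) (S : Set ι) : Set Z :=
  {z | ∀ i, 0 ≤ b.repr (c z) i ∧ (i ∈ S → 0 < b.repr (c z) i)}

/-- The points of `Z` in the half-open parallelepiped spanned by `b`. -/
def halfOpenBox (c : Z →+ E) (b : Module.Basis ι ℝ E) (S : Set ι) : Set Z :=
  {z | ∀ i, (i ∈ S → 0 < b.repr (c z) i ∧ b.repr (c z) i ≤ 1) ∧
    (i ∉ S → 0 ≤ b.repr (c z) i ∧ b.repr (c z) i < 1)}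

lemma halfOpenBox_bounds {c : Z →+ E} {b : Module.Basis ι ℝ E} {S : Set ι} {z : Z}
    (hz : z ∈ halfOpenBox c b S) (i : ι) : 0 ≤ b.repr (c z) i ∧ b.repr (c z) i ≤ 1 := by
  by_cases hi : i ∈ S
  · exact ⟨((hz i).1 hi).1.le, ((hz i).1 hi).2⟩
  · exact ⟨((hz i).2 hi).1, ((hz i).2 hi).2.le⟩

variable (c : Z →+ E) (b : Module.Basis ι ℝ E)

/-- The polynomial counting the points of a half-open simplicial cone at a given height. -/
def conePoly (d : ℕ) (deg : Z →+ ℤ) (S : Set ι) : ℚ[X] :=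
  ∑ᶠ p ∈ halfOpenBox c b S, (simplexPoly d).comp (X - C (deg p : ℚ))

lemma conePoly_eq_sum (d : ℕ) (deg : Z →+ ℤ) {S : Set ι} (hfin : (halfOpenBox c b S).Finite) :
    conePoly c b d deg S = ∑ p ∈ hfin.toFinset, (simplexPoly d).comp (X - C (deg p : ℚ)) :=
  finsum_mem_eq_finite_toFinset_sum _ hfin

lemma natDegree_conePoly_le (d : ℕ) (deg : Z →+ ℤ) {S : Set ι}
    (hfin : (halfOpenBox c b S).Finite) : (conePoly c b d deg S).natDegree ≤ d := by
  rw [conePoly_eq_sum c b d deg hfin]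
  refine natDegree_sum_le_of_forall_le _ _ fun p _ => natDegree_comp_le.trans ?_
  rw [natDegree_X_sub_C, mul_one]
  exact natDegree_simplexPoly_le d

variable [Fintype ι] (w : ι → Z)

lemma repr_add_sum_nsmul (hw : ∀ i, c (w i) = b i) (p : Z) (n : ι → ℕ) (i : ι) :
    b.repr (c (p + ∑ j, n j • w j)) i = b.repr (c p) i + n i := by
  classical
  have : c (∑ j, n j • w j) = ∑ j, (n j : ℝ) • b j := by
    simp [map_sum, hw, Nat.cast_smul_eq_nsmul]
  rw [map_add, this, map_add, Finsupp.add_apply, b.repr_sum_self]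

lemma bijOn_halfOpenBox (hw : ∀ i, c (w i) = b i) (deg : Z →+ ℤ) (hdeg : ∀ i, deg (w i) = 1)
    (S : Set ι) (m : ℤ) :
    Set.BijOn (fun q : Z × (ι → ℕ) => q.1 + ∑ j, q.2 j • w j)
      {q | q.1 ∈ halfOpenBox c b S ∧ ((∑ i, q.2 i : ℕ) : ℤ) = m - deg q.1}
      {z | z ∈ halfOpenCone c b S ∧ deg z = m} := by
  classical
  have hdegsum : ∀ (p : Z) (n : ι → ℕ),
      deg (p + ∑ j, n j • w j) = deg p + ((∑ i, n i : ℕ) : ℤ) := by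
    intro p n
    simp [map_sum, hdeg]
  refine ⟨?_, ?_, ?_⟩
  · rintro ⟨p, n⟩ ⟨hp, hn⟩
    refine ⟨fun i => ?_, by simp only [hdegsum]; simp only at hn; omega⟩
    rw [repr_add_sum_nsmul c b w hw]
    have := halfOpenBox_bounds hp i
    have hni : (0 : ℝ) ≤ n i := Nat.cast_nonneg _
    refine ⟨by linarith, fun hi => ?_⟩
    have := ((hp i).1 hi).1
    linarith
  · rintro ⟨p, n⟩ ⟨hp, hn⟩ ⟨p', n'⟩ ⟨hp', hn'⟩ h
    simp only at h hp hp'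
    have hnn : n = n' := by
      funext i
      have hi := congrArg (fun z => b.repr (c z) i) h
      simp only [repr_add_sum_nsmul c b w hw] at hi
      have h1 : ((n i : ℤ) : ℝ) < ((n' i + 1 : ℤ) : ℝ) := by
        push_cast
        by_cases hS : i ∈ S
        · have := (hp i).1 hS; have := (hp' i).1 hS; linarith
        · have := (hp i).2 hS; have := (hp' i).2 hS; linarith
      have h2 : ((n' i : ℤ) : ℝ) < ((n i + 1 : ℤ) : ℝ) := by
        push_cast
        by_cases hS : i ∈ S
        · have := (hp i).1 hS; have := (hp' i).1 hS; linarith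
        · have := (hp i).2 hS; have := (hp' i).2 hS; linarith
      have h1 := Int.cast_lt.mp h1
      have h2 := Int.cast_lt.mp h2
      omega
    subst hnn
    exact Prod.ext (add_right_cancel h) rfl
  · rintro z ⟨hz, hm⟩
    have key : ∀ i, ∃ n : ℕ, (i ∈ S → 0 < b.repr (c z) i - n ∧ b.repr (c z) i - n ≤ 1) ∧
        (i ∉ S → 0 ≤ b.repr (c z) i - n ∧ b.repr (c z) i - n < 1) := by
      intro i
      by_cases hS : i ∈ S
      · have h0 := (hz i).2 hS
        have hpos : 0 < ⌈b.repr (c z) i⌉₊ := Nat.ceil_pos.mpr h0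
        refine ⟨⌈b.repr (c z) i⌉₊ - 1, fun _ => ?_, fun h => absurd hS h⟩
        have h1 := Nat.ceil_lt_add_one h0.le
        have h2 := Nat.le_ceil (b.repr (c z) i)
        push_cast [Nat.cast_sub (show 1 ≤ ⌈b.repr (c z) i⌉₊ from hpos)]
        constructor <;> linarith
      · have h0 := (hz i).1
        refine ⟨⌊b.repr (c z) i⌋₊, fun h => absurd h hS, fun _ => ?_⟩
        have h1 := Nat.floor_le h0
        have h2 := Nat.lt_floor_add_one (b.repr (c z) i)
        constructor <;> linarith
    choose n hn using key
    have hrepr : ∀ i, b.repr (c (z - ∑ j, n j • w j)) i = b.repr (c z) i - n i := by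
      intro i
      have := repr_add_sum_nsmul c b w hw (z - ∑ j, n j • w j) n i
      rw [sub_add_cancel] at this
      linarith
    refine ⟨(z - ∑ j, n j • w j, n), ⟨fun i => ?_, ?_⟩, by simp⟩
    · simpa only [hrepr] using hn i
    · have := hdegsum (z - ∑ j, n j • w j) n
      rw [sub_add_cancel] at this
      simp only
      omega

lemma finite_and_ncard_halfOpenCone (hw : ∀ i, c (w i) = b i) (deg : Z →+ ℤ)
    (hdeg : ∀ i, deg (w i) = 1) (hdegsum : ∀ z, (deg z : ℝ) = ∑ i, b.repr (c z) i)
    {d : ℕ} (hι : Fintype.card ι = d + 1) {S : Set ι} (hfin : (halfOpenBox c b S).Finite)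
    {m : ℤ} (hm : 1 ≤ m) :
    {z | z ∈ halfOpenCone c b S ∧ deg z = m}.Finite ∧
    ({z | z ∈ halfOpenCone c b S ∧ deg z = m}.ncard : ℚ) = (conePoly c b d deg S).eval (m : ℚ) := by
  classical
  have hbij := bijOn_halfOpenBox c b w hw deg hdeg S m
  have hfinN : ∀ k : ℤ, {n : ι → ℕ | ((∑ i, n i : ℕ) : ℤ) = k}.Finite := by
    intro k
    refine (Set.finite_Iic (fun _ : ι => k.toNat)).subset fun n hn i => ?_
    have h1 : n i ≤ ∑ i, n i := Finset.single_le_sum (fun _ _ => Nat.zero_le _) (Finset.mem_univ i)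
    simp only [Set.mem_ofPred_eq] at hn
    simp only
    omega
  set F : Finset (Z × (ι → ℕ)) :=
    (hfin.toFinset.sigma fun p => (hfinN (m - deg p)).toFinset).map
      (Equiv.sigmaEquivProd Z (ι → ℕ)).toEmbedding with hF
  have hsrc : {q : Z × (ι → ℕ) | q.1 ∈ halfOpenBox c b S ∧
      ((∑ i, q.2 i : ℕ) : ℤ) = m - deg q.1} = (F : Set (Z × (ι → ℕ))) := by
    ext ⟨p, n⟩
    simp [hF]
  have hcard : F.card =
    ∑ p ∈ hfin.toFinset, {n : ι → ℕ | ((∑ i, n i : ℕ) : ℤ) = m - deg p}.ncard := by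
    rw [hF, Finset.card_map, Finset.card_sigma]
    exact Finset.sum_congr rfl fun p _ => (Set.ncard_eq_toFinset_card _ _).symm
  refine ⟨hbij.finite_iff_finite.mp (hsrc ▸ F.finite_toSet), ?_⟩
  rw [← hbij.ncard_eq, hsrc, Set.ncard_coe_finset, hcard, conePoly_eq_sum c b d deg hfin,
    eval_finsetSum, Nat.cast_sum]
  refine Finset.sum_congr rfl fun p hp => ?_
  have hle : (deg p : ℝ) ≤ ((d + 1 : ℤ) : ℝ) := by
    rw [hdegsum]
    refine (Finset.sum_le_sum fun i _ =>
      (halfOpenBox_bounds ((Set.Finite.mem_toFinset _).mp hp) i).2).trans ?_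
    simp [hι]
  have hle := Int.cast_le.mp hle
  rw [ncard_sum_eq_simplexPoly hι (by omega)]
  simp

/-- Reciprocity for half-open simplicial cones. -/
lemma conePoly_compl_eval (hw : ∀ i, c (w i) = b i) (deg : Z →+ ℤ)
    (hdeg : ∀ i, deg (w i) = 1) {d : ℕ} (hι : Fintype.card ι = d + 1) {S : Set ι}
    (hfin : ∀ S, (halfOpenBox c b S).Finite) (x : ℚ) :
    (conePoly c b d deg Sᶜ).eval x = (-1) ^ d * (conePoly c b d deg S).eval (-x) := by
  classical
  have hrepr : ∀ p i, b.repr (c (∑ j, w j - p)) i = 1 - b.repr (c p) i := by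
    intro p i
    have h1 := repr_add_sum_nsmul c b w hw 0 (fun _ => 1) i
    simp only [one_smul, zero_add, map_zero, Finsupp.zero_apply, Nat.cast_one] at h1
    rw [map_sub, map_sub, Finsupp.sub_apply, h1]
  have hmem : ∀ S p, p ∈ halfOpenBox c b S → ∑ j, w j - p ∈ halfOpenBox c b Sᶜ := by
    intro S p hp i
    rw [hrepr]
    refine ⟨fun hi => ?_, fun hi => ?_⟩
    · have := (hp i).2 hi
      constructor <;> linarith
    · have := (hp i).1 (not_not.mp hi)
      constructor <;> linarith
  have hd : deg (∑ j, w j) = d + 1 := by simp [map_sum, hdeg, hι]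
  rw [conePoly_eq_sum c b d deg (hfin S), conePoly_eq_sum c b d deg (hfin Sᶜ), eval_finsetSum,
    eval_finsetSum, Finset.mul_sum]
  refine Finset.sum_nbij' (fun p => ∑ j, w j - p) (fun p => ∑ j, w j - p) ?_ ?_ ?_ ?_ ?_
  · intro p hp
    simpa using hmem _ _ ((Set.Finite.mem_toFinset _).mp hp)
  · intro p hp
    simpa using hmem _ _ ((Set.Finite.mem_toFinset _).mp hp)
  · simp
  · simp
  · intro p _
    simp only [eval_comp, eval_sub, eval_X, eval_C, map_sub, hd]
    rw [← simplexPoly_eval_reflect]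
    congr 1
    push_cast
    ring

end HalfOpen

section Triangulation

variable {V E : Type*} [Fintype V] [AddCommGroup E] [Module ℝ E]

/-- `l` has least cost `ω` among the nonnegative coefficient vectors representing the same point. -/
def IsCheapest (w : V → E) (ω : (V → ℝ) →ₗ[ℝ] ℝ) (l : V → ℝ) : Prop :=
  0 ≤ l ∧ ∀ k : V → ℝ, 0 ≤ k → ∑ v, k v • w v = ∑ v, l v • w v → ω l ≤ ω k

/-- A vector that is positive where `g` is nonzero can be moved slightly along `g`. -/
lemma exists_pos_add_smul_nonneg {l g : V → ℝ} (hl : 0 ≤ l) (hg : ∀ v, l v = 0 → 0 ≤ g v) :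
    ∃ t : ℝ, 0 < t ∧ 0 ≤ l + t • g := by
  have h : ∀ v, ∀ᶠ t in nhdsWithin (0 : ℝ) (Set.Ioi 0), 0 ≤ l v + t * g v := by
    intro v
    rcases (hl v).eq_or_lt with h0 | h0
    · filter_upwards [self_mem_nhdsWithin] with t ht
      have := mul_nonneg (le_of_lt ht) (hg v h0.symm)
      have : l v = 0 := h0.symm
      linarith
    · have hc : Filter.Tendsto (fun t : ℝ => l v + t * g v) (nhdsWithin 0 (Set.Ioi 0))
          (nhds (l v)) := by
        have : Continuous fun t : ℝ => l v + t * g v := by fun_prop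
        simpa using (this.tendsto 0).mono_left nhdsWithin_le_nhds
      filter_upwards [hc.eventually (lt_mem_nhds (show 0 < l v from h0))] with t ht
        using le_of_lt ht
  obtain ⟨t, ht, h0⟩ := ((Filter.eventually_all.mpr h).and self_mem_nhdsWithin).exists
  exact ⟨t, h0, fun v => by simpa using ht v⟩

lemma IsCheapest.of_support_subset {w : V → E} {ω : (V → ℝ) →ₗ[ℝ] ℝ} {l₀ l : V → ℝ}
    (h₀ : IsCheapest w ω l₀) (hl : 0 ≤ l) (hsupp : ∀ v, l₀ v = 0 → l v = 0) :
    IsCheapest w ω l := by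
  refine ⟨hl, fun k hk hkl => ?_⟩
  obtain ⟨t, ht, hnn⟩ := exists_pos_add_smul_nonneg (g := k - l) h₀.1 fun v hv => by
    simpa [hsupp v hv] using hk v
  have := h₀.2 _ hnn (by
    simp only [Pi.add_apply, Pi.smul_apply, Pi.sub_apply, smul_eq_mul, add_smul, mul_smul,
      sub_smul, Finset.sum_add_distrib, ← Finset.smul_sum, Finset.sum_sub_distrib, hkl]
    simp)
  rw [map_add, map_smul, map_sub, smul_eq_mul] at this
  nlinarith

/-- A cost functional for which cheapest representations have independent support. -/
lemma exists_generic_cost (w : V → E) : ∃ ω : (V → ℝ) →ₗ[ℝ] ℝ, ∀ l, IsCheapest w ω l →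
    ∀ g : V → ℝ, (∀ v, l v = 0 → g v = 0) → ∑ v, g v • w v = 0 → g = 0 := by
  classical
  let D := {s : Finset V // ∃ g : V → ℝ, g ≠ 0 ∧ (∀ v ∉ s, g v = 0) ∧ ∑ v, g v • w v = 0}
  choose g hg0 hgs hgw using fun s : D => s.2
  obtain ⟨ω, hω⟩ := Module.exists_dual_forall_apply_ne_zero (K := ℝ) g hg0
  refine ⟨ω, fun l hl f hf hfw => ?_⟩
  by_contra hf0
  let s : D := ⟨Finset.univ.filter fun v => l v ≠ 0, f, hf0, fun v hv => hf v (by simpa using hv),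
    hfw⟩
  have hs : ∀ v, l v = 0 → g s v = 0 := fun v hv => hgs s v (by simp [s, hv])
  have hmove : ∀ r : ℝ, 0 ≤ ω (r • g s) := by
    intro r
    obtain ⟨t, ht, hnn⟩ := exists_pos_add_smul_nonneg (g := r • g s) hl.1 fun v hv => by
      simp [hs v hv]
    have := hl.2 _ hnn (by
      simp only [Pi.add_apply, Pi.smul_apply, smul_eq_mul, add_smul, mul_smul,
        Finset.sum_add_distrib, ← Finset.smul_sum, hgw]
      simp)
    rw [map_add, map_smul _ t, smul_eq_mul] at this
    nlinarith
  have h1 := hmove 1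
  have h2 := hmove (-1)
  rw [map_smul, smul_eq_mul] at h1 h2
  exact hω s (by linarith)

lemma exists_isCheapest [TopologicalSpace E] [T2Space E] [ContinuousAdd E] [ContinuousSMul ℝ E]
    (w : V → E) (deg : E →ₗ[ℝ] ℝ) (hdeg : ∀ v, deg (w v) = 1)
    (ω : (V → ℝ) →ₗ[ℝ] ℝ) (k : V → ℝ) (hk : 0 ≤ k) :
    ∃ l, IsCheapest w ω l ∧ ∑ v, l v • w v = ∑ v, k v • w v := by
  set A : Set (V → ℝ) := {l | 0 ≤ l ∧ ∑ v, l v • w v = ∑ v, k v • w v} with hA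
  have hsum : ∀ l : V → ℝ, deg (∑ v, l v • w v) = ∑ v, l v := by simp [map_sum, hdeg]
  have hclosed : IsClosed A := by
    refine isClosed_Ici.inter (isClosed_eq ?_ continuous_const)
    fun_prop
  have hsub : A ⊆ Set.Icc 0 fun _ => ∑ v, k v := by
    rintro l ⟨hl, hlk⟩
    refine ⟨hl, fun v => ?_⟩
    rw [← hsum k, ← hlk, hsum l]
    exact Finset.single_le_sum (fun i _ => hl i) (Finset.mem_univ v)
  have hcomp : IsCompact A := isCompact_Icc.of_isClosed_subset hclosed hsub
  obtain ⟨l, hl, hmin⟩ := hcomp.exists_isMinOn ⟨k, hk, rfl⟩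
    (LinearMap.continuous_of_finiteDimensional ω).continuousOn
  refine ⟨l, ⟨hl.1, fun m hm hml => hmin ⟨hm, hml.trans hl.2⟩⟩, hl.2⟩

/-- A finitely generated pointed cone has a triangulation without new rays: `T` is its set of
faces, and every point of the cone lies in the relative interior of exactly one face. -/
theorem exists_triangulation [TopologicalSpace E] [T2Space E] [ContinuousAdd E]
    [ContinuousSMul ℝ E] (w : V → E) (deg : E →ₗ[ℝ] ℝ) (hdeg : ∀ v, deg (w v) = 1) :
    ∃ T : Set (Set V), (∀ s ∈ T, LinearIndepOn ℝ w s) ∧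
      (∀ k : V → ℝ, 0 ≤ k →
        ∃ l : V → ℝ, 0 ≤ l ∧ Function.support l ∈ T ∧ ∑ v, l v • w v = ∑ v, k v • w v) ∧
      (∀ k l : V → ℝ, 0 ≤ k → 0 ≤ l → Function.support k ∈ T → Function.support l ∈ T →
        ∑ v, l v • w v = ∑ v, k v • w v → k = l) := by
  classical
  obtain ⟨ω, hω⟩ := exists_generic_cost w
  refine ⟨{s | ∃ l, IsCheapest w ω l ∧ Function.support l = s}, ?_, ?_, ?_⟩
  · rintro s ⟨l, hl, rfl⟩
    rw [LinearIndepOn, Fintype.linearIndependent_iff]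
    intro g hg i
    have h := hω l hl (fun v => if hv : v ∈ Function.support l then g ⟨v, hv⟩ else 0)
      (fun v hv => by simp [hv]) (by
        rw [← hg]
        refine (Fintype.sum_of_injective _ Subtype.val_injective _ _ (fun v hv => ?_)
          fun v => ?_).symm
        · rw [dif_neg (by simpa using hv), zero_smul]
        · rw [dif_pos v.2])
    simpa using congrFun h i
  · intro k hk
    obtain ⟨l, hl, hlk⟩ := exists_isCheapest w deg hdeg ω k hk
    exact ⟨l, hl.1, ⟨l, hl, rfl⟩, hlk⟩
  · rintro k l hk hl ⟨k₀, hk₀, hks⟩ ⟨l₀, hl₀, hls⟩ hkl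
    have hk' : IsCheapest w ω k := hk₀.of_support_subset hk fun v hv => by
      rw [← Function.notMem_support, ← hks]; simpa using hv
    have hl' : IsCheapest w ω l := hl₀.of_support_subset hl fun v hv => by
      rw [← Function.notMem_support, ← hls]; simpa using hv
    have hcost : ω k = ω l := le_antisymm (hk'.2 l hl hkl) (hl'.2 k hk hkl.symm)
    have hsum : ∑ v, (k + l) v • w v = (2 : ℝ) • ∑ v, k v • w v := by
      simp only [Pi.add_apply, add_smul, Finset.sum_add_distrib, hkl, two_smul]
    have hmid : IsCheapest w ω (k + l) := by
      refine ⟨add_nonneg hk hl, fun m hm hmkl => ?_⟩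
      have := hk'.2 ((1 / 2 : ℝ) • m) (smul_nonneg (by norm_num) hm) (by
        simp only [Pi.smul_apply, smul_assoc, ← Finset.smul_sum]
        rw [hmkl, hsum, smul_smul]
        norm_num)
      rw [map_smul, smul_eq_mul] at this
      rw [map_add]
      linarith
    have := hω _ hmid (k - l) (fun v hv => by
      have h1 : 0 ≤ k v := hk v
      have h2 : 0 ≤ l v := hl v
      simp only [Pi.add_apply] at hv
      simp only [Pi.sub_apply]
      linarith) (by simp [sub_smul, Finset.sum_sub_distrib, hkl])
    exact sub_eq_zero.mp this

end Triangulation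

section GenericDirection

open Filter Topology

lemma eventually_pos_add_mul_iff (r : ℝ) {g : ℝ} (hg : g ≠ 0) :
    ∀ᶠ ε in 𝓝[>] (0 : ℝ), (0 < r + ε * g ↔ 0 ≤ r ∧ (g < 0 → 0 < r)) := by
  have hc : Tendsto (fun ε : ℝ => r + ε * g) (𝓝[>] 0) (𝓝 r) := by
    have : Continuous fun ε : ℝ => r + ε * g := by fun_prop
    simpa using (this.tendsto 0).mono_left nhdsWithin_le_nhds
  rcases lt_trichotomy r 0 with hr | rfl | hr
  · filter_upwards [hc.eventually (gt_mem_nhds hr)] with ε hε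
    exact ⟨fun h => absurd h hε.not_gt, fun h => absurd h.1 hr.not_ge⟩
  · filter_upwards [self_mem_nhdsWithin] with ε (hε : 0 < ε)
    rw [zero_add, mul_pos_iff_of_pos_left hε]
    exact ⟨fun h => ⟨le_rfl, fun h' => absurd h h'.not_gt⟩,
      fun h => (lt_or_gt_of_ne hg).resolve_left fun h' => lt_irrefl _ (h.2 h')⟩
  · filter_upwards [hc.eventually (lt_mem_nhds hr)] with ε hε
    exact ⟨fun _ => ⟨hr.le, fun _ => hr⟩, fun _ => hε⟩

lemma eventually_add_smul_notMem {E : Type*} [AddCommGroup E] [Module ℝ E] {S : Submodule ℝ E}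
    {v : E} (hv : v ∉ S) (y : E) : ∀ᶠ ε in 𝓝[>] (0 : ℝ), y + ε • v ∉ S := by
  by_cases h : ∃ ε₀ : ℝ, 0 < ε₀ ∧ y + ε₀ • v ∈ S
  · obtain ⟨ε₀, hpos, h₀⟩ := h
    filter_upwards [Ioo_mem_nhdsGT hpos] with ε hε hmem
    have hsub := S.sub_mem h₀ hmem
    rw [add_sub_add_left_eq_sub, ← sub_smul] at hsub
    exact hv ((S.smul_mem_iff (sub_ne_zero.mpr hε.2.ne')).mp hsub)
  · filter_upwards [self_mem_nhdsWithin] with ε hε hmem using h ⟨ε, hε, hmem⟩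

variable {V E : Type*} [AddCommGroup E] [Module ℝ E]

/-- `v` lies in no proper subspace spanned by vectors of the family `w`. -/
def IsGeneric (w : V → E) (v : E) : Prop :=
  ∀ s : Set V, Submodule.span ℝ (w '' s) ≠ ⊤ → v ∉ Submodule.span ℝ (w '' s)

lemma IsGeneric.neg {w : V → E} {v : E} (hv : IsGeneric w v) : IsGeneric w (-v) :=
  fun s hs h => hv s hs (by simpa using h)

lemma IsGeneric.repr_ne_zero {w : V → E} {v : E} (hv : IsGeneric w v) {s : Set V}
    (b : Module.Basis s ℝ E) (hb : ∀ i, b i = w i) (i : s) : b.repr v i ≠ 0 := by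
  intro h0
  have himg : w '' (s \ {i.1}) = b '' {i}ᶜ := by
    ext x
    constructor
    · rintro ⟨j, ⟨hj, hji⟩, rfl⟩
      exact ⟨⟨j, hj⟩, fun h => hji (congrArg Subtype.val h), hb _⟩
    · rintro ⟨j, hj, rfl⟩
      exact ⟨j, ⟨j.2, fun h => hj (Subtype.ext h)⟩, (hb j).symm⟩
  have hmem : ∀ x, x ∈ Submodule.span ℝ (w '' (s \ {i.1})) ↔ b.repr x i = 0 := by
    intro x
    rw [himg, b.mem_span_image]
    constructor
    · intro h
      by_contra hne
      exact h (Finset.mem_coe.mpr (Finsupp.mem_support_iff.mpr hne)) rfl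
    · intro h j hj hji
      exact Finsupp.mem_support_iff.mp hj ((show j = i from hji) ▸ h)
  refine hv (s \ {i.1}) (fun htop => ?_) ((hmem v).mpr h0)
  have := (hmem (b i)).mp (htop ▸ Submodule.mem_top)
  simp at this

variable [Fintype V]

lemma exists_isGeneric (w : V → E) : ∃ v, IsGeneric w v := by
  obtain ⟨v, hv⟩ := Submodule.exists_forall_notMem_of_forall_ne_top (K := ℝ)
    (fun s : {s : Set V // Submodule.span ℝ (w '' s) ≠ ⊤} => Submodule.span ℝ (w '' s.1))
    fun s => s.2
  exact ⟨v, fun s hs => hv ⟨s, hs⟩⟩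

/-- The cone generated by a finite family of vectors. -/
def coneOf (w : V → E) : Set E := {y | ∃ k : V → ℝ, 0 ≤ k ∧ ∑ v, k v • w v = y}

/-- A generic direction turns a triangulation of a cone into a disjoint decomposition into
half-open simplicial cones. -/
theorem exists_halfOpen_decomposition [TopologicalSpace E] [T2Space E] [ContinuousAdd E]
    [ContinuousSMul ℝ E] (w : V → E) (deg : E →ₗ[ℝ] ℝ) (hdeg : ∀ v, deg (w v) = 1) :
    ∃ (T : Set (Set V)) (b : ∀ s : T, Module.Basis s.1 ℝ E), (∀ s i, b s i = w i) ∧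
      ∀ v, IsGeneric w v → ∀ y,
        (∀ᶠ ε in 𝓝[>] (0 : ℝ), (y + ε • v ∈ coneOf w ↔
          ∃ s : T, ∀ i, 0 ≤ (b s).repr y i ∧ ((b s).repr v i < 0 → 0 < (b s).repr y i))) ∧
        ∀ s s' : T, (∀ i, 0 ≤ (b s).repr y i ∧ ((b s).repr v i < 0 → 0 < (b s).repr y i)) →
          (∀ i, 0 ≤ (b s').repr y i ∧ ((b s').repr v i < 0 → 0 < (b s').repr y i)) → s = s' := by
  classical
  obtain ⟨T, hind, hex, huniq⟩ := exists_triangulation w deg hdeg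
  let F : Set (Set V) := {s | s ∈ T ∧ Submodule.span ℝ (w '' s) = ⊤}
  let b : ∀ s : F, Module.Basis s.1 ℝ E := fun s =>
    Module.Basis.mk (hind s.1 s.2.1) (by
      rw [← s.2.2, Set.image_eq_range])
  have hb : ∀ s i, b s i = w i := fun s i => Module.Basis.mk_apply _ _ i
  let ext : ∀ s : F, E → V → ℝ := fun s y v => if hv : v ∈ s.1 then (b s).repr y ⟨v, hv⟩ else 0
  have hext : ∀ s y, ∑ v, ext s y v • w v = y := by
    intro s y
    conv_rhs => rw [← (b s).sum_repr y]
    refine (Fintype.sum_of_injective _ Subtype.val_injective _ _ (fun v hv => ?_)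
      fun v => ?_).symm
    · simp only [ext]
      rw [dif_neg (by simpa using hv), zero_smul]
    · simp only [ext]
      rw [dif_pos v.2, hb]
  have hext_nonneg : ∀ s y, (∀ i, 0 < (b s).repr y i) → 0 ≤ ext s y := by
    intro s y h v
    by_cases hv : v ∈ s.1
    · simpa [ext, hv] using (h ⟨v, hv⟩).le
    · simp [ext, hv]
  have hext_supp : ∀ s y, (∀ i, 0 < (b s).repr y i) → Function.support (ext s y) = s.1 := by
    intro s y h
    ext v
    by_cases hv : v ∈ s.1
    · simpa [ext, hv] using (h ⟨v, hv⟩).ne'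
    · simp [ext, hv]
  refine ⟨F, b, hb, fun v hv y => ?_⟩
  have hsign : ∀ᶠ ε in 𝓝[>] (0 : ℝ), ∀ s : F, ((∀ i, 0 < (b s).repr (y + ε • v) i) ↔
      ∀ i, 0 ≤ (b s).repr y i ∧ ((b s).repr v i < 0 → 0 < (b s).repr y i)) := by
    refine eventually_all.mpr fun s => ?_
    have := eventually_all.mpr fun i : s.1 =>
      eventually_pos_add_mul_iff ((b s).repr y i) (hv.repr_ne_zero (b s) (hb s) i)
    filter_upwards [this] with ε hε
    refine forall_congr' fun i => ?_
    rw [← hε i]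
    simp
  have hgen : ∀ᶠ ε in 𝓝[>] (0 : ℝ), ∀ s : Set V, Submodule.span ℝ (w '' s) ≠ ⊤ →
      y + ε • v ∉ Submodule.span ℝ (w '' s) := by
    refine eventually_all.mpr fun s => ?_
    by_cases hs : Submodule.span ℝ (w '' s) = ⊤
    · exact Eventually.of_forall fun _ h => absurd hs h
    · filter_upwards [eventually_add_smul_notMem (hv s hs) y] with ε hε _ using hε
  have hpos_unique : ∀ z, ∀ s s' : F, (∀ i, 0 < (b s).repr z i) → (∀ i, 0 < (b s').repr z i) →
      s = s' := by
    intro z s s' hs hs'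
    have := huniq _ _ (hext_nonneg s z hs) (hext_nonneg s' z hs')
      (by rw [hext_supp s z hs]; exact s.2.1) (by rw [hext_supp s' z hs']; exact s'.2.1)
      (by rw [hext, hext])
    refine Subtype.ext ?_
    rw [← hext_supp s z hs, ← hext_supp s' z hs', this]
  constructor
  · filter_upwards [hsign, hgen] with ε hε hg
    constructor
    · rintro ⟨k, hk, hky⟩
      obtain ⟨l, hl, hlT, hlk⟩ := hex k hk
      have hly : ∑ u, l u • w u = y + ε • v := hlk.trans hky
      have hmem : y + ε • v ∈ Submodule.span ℝ (w '' Function.support l) := by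
        rw [← hly]
        refine Submodule.sum_mem _ fun u _ => ?_
        by_cases hu : l u = 0
        · simp [hu]
        · exact Submodule.smul_mem _ _ (Submodule.subset_span ⟨u, hu, rfl⟩)
      have htop : Submodule.span ℝ (w '' Function.support l) = ⊤ := by
        by_contra h
        exact hg _ h hmem
      let s : F := ⟨Function.support l, hlT, htop⟩
      refine ⟨s, (hε s).mp fun i => ?_⟩
      have hrepr : (b s).repr (y + ε • v) i = l i := by
        have hsum : ∑ j : s.1, l j • b s j = y + ε • v := by
          rw [← hly]
          refine Fintype.sum_of_injective _ Subtype.val_injective _ _ (fun u hu => ?_)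
            fun u => by rw [hb]
          have : l u = 0 := by simpa [s] using hu
          rw [this, zero_smul]
        rw [← hsum, Module.Basis.repr_sum_self]
      rw [hrepr]
      exact lt_of_le_of_ne (hl i) (Ne.symm i.2)
    · rintro ⟨s, hs⟩
      exact ⟨ext s (y + ε • v), hext_nonneg s _ ((hε s).mpr hs), hext s _⟩
  · intro s s' hs hs'
    obtain ⟨ε, hε⟩ := hsign.exists
    exact hpos_unique _ s s' ((hε s).mpr hs) ((hε s').mpr hs')

end GenericDirection

section Reflexive

open Filter Topology

variable {d : ℕ}

/-- The real vector of an integer vector together with its height. -/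
def latticeCast (d : ℕ) : (Fin d → ℤ) × ℤ →+ (Fin d → ℝ) × ℝ where
  toFun z := (fun i => (z.1 i : ℝ), (z.2 : ℝ))
  map_zero' := by ext <;> simp
  map_add' _ _ := by ext <;> simp

lemma latticeCast_apply (z : (Fin d → ℤ) × ℤ) :
    latticeCast d z = (fun i => (z.1 i : ℝ), (z.2 : ℝ)) := rfl

lemma finite_norm_latticeCast_le (C : ℝ) : {z | ‖latticeCast d z‖ ≤ C}.Finite := by
  have hcoord : ∀ n : ℤ, ‖(n : ℝ)‖ ≤ C → -⌈C⌉ ≤ n ∧ n ≤ ⌈C⌉ := by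
    intro n hn
    rw [Real.norm_eq_abs, abs_le] at hn
    have h2 := Int.le_ceil C
    constructor
    · have : (-⌈C⌉ : ℝ) ≤ n := by linarith
      exact_mod_cast this
    · have : (n : ℝ) ≤ ⌈C⌉ := by linarith
      exact_mod_cast this
  refine ((Set.finite_Icc (fun _ : Fin d => -⌈C⌉) fun _ => ⌈C⌉).prod
    (Set.finite_Icc (-⌈C⌉) ⌈C⌉)).subset ?_
  intro z hz
  have hz : ‖latticeCast d z‖ ≤ C := hz
  have h1 := fun i => hcoord (z.1 i)
    ((norm_le_pi_norm (latticeCast d z).1 i).trans ((norm_fst_le _).trans hz))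
  have h2 := hcoord z.2 ((norm_snd_le (latticeCast d z)).trans hz)
  exact ⟨⟨fun i => (h1 i).1, fun i => (h1 i).2⟩, h2⟩

lemma finite_halfOpenBox_latticeCast {ι : Type*} [Fintype ι]
    (b : Module.Basis ι ℝ ((Fin d → ℝ) × ℝ)) (S : Set ι) :
    (halfOpenBox (latticeCast d) b S).Finite := by
  refine (finite_norm_latticeCast_le (∑ i, ‖b i‖)).subset fun z hz => ?_
  have hz' := halfOpenBox_bounds hz
  simp only [Set.mem_ofPred_eq]
  rw [← b.sum_repr (latticeCast d z)]
  refine (norm_sum_le _ _).trans (Finset.sum_le_sum fun i _ => ?_)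
  rw [norm_smul, Real.norm_eq_abs, abs_of_nonneg (hz' i).1]
  exact mul_le_of_le_one_left (norm_nonneg _) (hz' i).2

/-- The affine functional `x ↦ ⟨u, x⟩ + t` homogenizing a facet inequality. -/
def facetForm (u : Fin d → ℤ) : (Fin d → ℝ) × ℝ →ₗ[ℝ] ℝ where
  toFun y := ∑ i, (u i : ℝ) * y.1 i + y.2
  map_add' x y := by
    simp only [Prod.fst_add, Prod.snd_add, Pi.add_apply, mul_add, Finset.sum_add_distrib]
    ring
  map_smul' r x := by
    simp only [Prod.smul_fst, Prod.smul_snd, Pi.smul_apply, smul_eq_mul, RingHom.id_apply, mul_add,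
      Finset.mul_sum]
    congr 1
    exact Finset.sum_congr rfl fun i _ => by ring

lemma facetForm_apply (u : Fin d → ℤ) (y : (Fin d → ℝ) × ℝ) :
    facetForm u y = ∑ i, (u i : ℝ) * y.1 i + y.2 := rfl

lemma isClosed_of_isLatticePolytope {P : Set (Fin d → ℝ)} (hP : IsLatticePolytope d P) :
    IsClosed P ∧ Convex ℝ P := by
  obtain ⟨V, rfl⟩ := hP
  exact ⟨((V.finite_toSet.image _).isCompact_convexHull ℝ).isClosed, convex_convexHull ℝ _⟩

/-- The bipolar theorem for a closed convex set containing the origin. -/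
lemma mem_of_forall_dualBody {P : Set (Fin d → ℝ)} (hcl : IsClosed P) (hconv : Convex ℝ P)
    (h0 : 0 ∈ P) {x : Fin d → ℝ} (hx : ∀ u ∈ dualBody d P, -1 ≤ ∑ i, u i * x i) : x ∈ P := by
  classical
  by_contra hxP
  obtain ⟨f, r, hfx, hfP⟩ := geometric_hahn_banach_point_closed hconv hcl hxP
  have hr : r < 0 := by simpa using hfP 0 h0
  have hf : ∀ y : Fin d → ℝ, f y = ∑ i, f (Pi.single i 1) * y i := by
    intro y
    conv_lhs => rw [← Finset.univ_sum_single y]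
    rw [map_sum]
    refine Finset.sum_congr rfl fun i _ => ?_
    rw [show Pi.single i (y i) = y i • (Pi.single i 1 : Fin d → ℝ) by
      rw [← Pi.single_smul]; simp, map_smul, smul_eq_mul, mul_comm]
  have hdot : ∀ y : Fin d → ℝ, ∑ i, ((-r)⁻¹ * f (Pi.single i 1)) * y i = (-r)⁻¹ * f y := by
    intro y
    rw [hf y, Finset.mul_sum]
    exact Finset.sum_congr rfl fun i _ => by ring
  have hpos : 0 < (-r)⁻¹ := inv_pos.mpr (by linarith)
  have hinv : (-r)⁻¹ * r = -1 := by rw [inv_neg, neg_mul, inv_mul_cancel₀ hr.ne]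
  have := hx (fun i => (-r)⁻¹ * f (Pi.single i 1)) fun y hy => by
    rw [hdot]
    have := hfP y hy
    nlinarith
  rw [hdot] at this
  nlinarith

/-- The dilates of a reflexive polytope are cut out by integral facet inequalities. -/
lemma exists_mem_smul_iff_facetForm {P : Set (Fin d → ℝ)} (hP : IsLatticePolytope d P)
    (href : IsReflexive d P) : ∃ U : Finset (Fin d → ℤ), ∀ (x : Fin d → ℝ) (t : ℝ), 0 < t →
      (x ∈ t • P ↔ ∀ u ∈ U, 0 ≤ facetForm u (x, t)) := by
  obtain ⟨hcl, hconv⟩ := isClosed_of_isLatticePolytope hP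
  obtain ⟨hzero, U, hU⟩ := href
  have hmemP : ∀ x, x ∈ P ↔ ∀ u ∈ U, -1 ≤ ∑ i, (u i : ℝ) * x i := by
    intro x
    constructor
    · intro hx u hu
      have : (fun i => (u i : ℝ)) ∈ dualBody d P := by
        rw [hU]
        exact subset_convexHull ℝ _ ⟨u, hu, rfl⟩
      exact this x hx
    · intro hx
      refine mem_of_forall_dualBody hcl hconv (interior_subset hzero) fun u hu => ?_
      have hsub : dualBody d P ⊆ {u | -1 ≤ ∑ i, u i * x i} := by
        rw [hU]
        refine convexHull_min ?_ ?_
        · rintro _ ⟨u, hu, rfl⟩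
          exact hx u hu
        · refine convex_halfSpace_ge ⟨fun a b => ?_, fun r a => ?_⟩ _
          · simp [add_mul, Finset.sum_add_distrib]
          · simp [Finset.mul_sum, mul_assoc]
      exact hsub hu
  refine ⟨U, fun x t ht => ?_⟩
  rw [Set.mem_smul_set_iff_inv_smul_mem₀ ht.ne', hmemP]
  refine forall₂_congr fun u _ => ?_
  have : ∑ i, (u i : ℝ) * (t⁻¹ • x) i = t⁻¹ * ∑ i, (u i : ℝ) * x i := by
    rw [Finset.mul_sum]
    exact Finset.sum_congr rfl fun i _ => by simp only [Pi.smul_apply, smul_eq_mul]; ring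
  rw [this, facetForm_apply, ← div_eq_inv_mul, le_div_iff₀ ht]
  constructor <;> intro h <;> linarith

/-- The cone over a lattice polytope. -/
lemma mem_coneOf_iff_mem_smul (V : Finset (Fin d → ℤ)) (x : Fin d → ℝ) {t : ℝ} (ht : 0 < t) :
    (x, t) ∈ coneOf (fun v : V => latticeCast d (v.1, 1)) ↔
      x ∈ t • convexHull ℝ
        ((fun v : Fin d → ℤ => fun i => (v i : ℝ)) '' (V : Set (Fin d → ℤ))) := by
  classical
  have hrange : (fun v : Fin d → ℤ => fun i => (v i : ℝ)) '' (V : Set (Fin d → ℤ)) =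
      Set.range fun v : V => fun i => ((v.1 i : ℤ) : ℝ) := by
    ext x
    simp
  rw [Set.mem_smul_set_iff_inv_smul_mem₀ ht.ne', hrange]
  constructor
  · rintro ⟨k, hk, hkx⟩
    have h1 : ∑ v, k v • (fun i => ((v.1 i : ℤ) : ℝ)) = x := by
      have := congrArg Prod.fst hkx
      simpa [Prod.fst_sum, latticeCast_apply] using this
    have h2 : ∑ v, k v = t := by
      have := congrArg Prod.snd hkx
      simpa [Prod.snd_sum, latticeCast_apply] using this
    refine mem_convexHull_of_exists_fintype (fun v => t⁻¹ * k v)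
      (fun v => fun i => ((v.1 i : ℤ) : ℝ))
      (fun v => mul_nonneg (inv_nonneg.mpr ht.le) (hk v)) ?_ (fun v => ⟨v, rfl⟩) ?_
    · rw [← Finset.mul_sum, h2, inv_mul_cancel₀ ht.ne']
    · simp only [mul_smul]
      rw [← Finset.smul_sum, h1]
  · intro hx
    have hinj : Function.Injective fun v : Fin d → ℤ => fun i => (v i : ℝ) := fun u v h => by
      funext i
      exact Int.cast_injective (congrFun h i)
    rw [← hrange, ← Finset.coe_image, Finset.mem_convexHull'] at hx
    obtain ⟨g, hg0, hg1, hgx⟩ := hx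
    rw [Finset.sum_image hinj.injOn, ← Finset.sum_coe_sort] at hg1 hgx
    refine ⟨fun v => t * g fun i => (v.1 i : ℝ), fun v => mul_nonneg ht.le
      (hg0 _ (Finset.mem_image_of_mem _ v.2)), Prod.ext ?_ ?_⟩
    · have := congrArg (fun z => t • z) hgx
      simp only [smul_inv_smul₀ ht.ne', Finset.smul_sum] at this
      rw [← this]
      simp [Prod.fst_sum, latticeCast_apply, mul_smul]
    · have : ∑ v : V, t * g (fun i => (v.1 i : ℝ)) = t := by rw [← Finset.mul_sum, hg1, mul_one]
      simpa [Prod.snd_sum, latticeCast_apply] using this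

/-- A generic vector on which all facet forms are positive. -/
lemma exists_isGeneric_facetForm_pos {V : Type*} [Fintype V] (w : V → (Fin d → ℝ) × ℝ)
    (U : Finset (Fin d → ℤ)) : ∃ v, IsGeneric w v ∧ ∀ u ∈ U, 0 < facetForm u v := by
  obtain ⟨g, hg⟩ := exists_isGeneric w
  have h1 : ∀ᶠ ε in 𝓝[>] (0 : ℝ), IsGeneric w ((0, 1) + ε • g) := by
    refine eventually_all.mpr fun s => ?_
    by_cases hs : Submodule.span ℝ (w '' s) = ⊤
    · exact Eventually.of_forall fun _ h => absurd hs h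
    · filter_upwards [eventually_add_smul_notMem (hg s hs) (0, 1)] with ε hε _ using hε
  have h2 : ∀ᶠ ε in 𝓝[>] (0 : ℝ), ∀ u ∈ U, 0 < facetForm u ((0, 1) + ε • g) := by
    refine (Filter.eventually_all_finset U).mpr fun u _ => ?_
    have hc : Tendsto (fun ε : ℝ => 1 + ε * facetForm u g) (𝓝[>] 0) (𝓝 1) := by
      have : Continuous fun ε : ℝ => 1 + ε * facetForm u g := by fun_prop
      simpa using (this.tendsto 0).mono_left nhdsWithin_le_nhds
    filter_upwards [hc.eventually (lt_mem_nhds one_pos)] with ε hε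
    rw [map_add, map_smul, smul_eq_mul]
    simpa [facetForm_apply (y := (0, 1))] using hε
  obtain ⟨ε, hε⟩ := (h1.and h2).exists
  exact ⟨_, hε⟩

lemma facetForm_latticeCast (u : Fin d → ℤ) (z : (Fin d → ℤ) × ℤ) :
    facetForm u (latticeCast d z) = ((∑ i, u i * z.1 i + z.2 : ℤ) : ℝ) := by
  simp [facetForm_apply, latticeCast_apply]

lemma eventually_nonneg_add_mul_iff {r g : ℝ} (hg : 0 < g) :
    ∀ᶠ ε in 𝓝[>] (0 : ℝ), (0 ≤ r + ε * g ↔ 0 ≤ r) := by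
  filter_upwards [eventually_pos_add_mul_iff r hg.ne',
    eventually_pos_add_mul_iff (-r) (neg_ne_zero.mpr hg.ne')] with ε h1 h2
  constructor
  · intro h
    by_contra hr
    have := h2.mpr ⟨by linarith, fun _ => by linarith⟩
    linarith
  · intro h
    exact (h1.mpr ⟨h, fun h' => absurd h' hg.not_gt⟩).le

lemma eventually_nonneg_sub_mul_iff {r g : ℝ} (hg : 0 < g) :
    ∀ᶠ ε in 𝓝[>] (0 : ℝ), (0 ≤ r - ε * g ↔ 0 < r) := by
  filter_upwards [eventually_pos_add_mul_iff (-r) hg.ne',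
    eventually_pos_add_mul_iff r (neg_ne_zero.mpr hg.ne')] with ε h1 h2
  constructor
  · intro h
    by_contra hr
    have := h1.mpr ⟨by linarith, fun h' => absurd h' hg.not_gt⟩
    linarith
  · intro h
    have := h2.mpr ⟨h.le, fun _ => h⟩
    linarith

/-- Summing the counting polynomials of a decomposition into half-open simplicial cones. -/
lemma ncard_eq_eval_sum_conePoly {V : Finset (Fin d → ℤ)} {T : Set (Set V)} [Fintype T]
    (b : ∀ s : T, Module.Basis s.1 ℝ ((Fin d → ℝ) × ℝ))
    (hb : ∀ s i, b s i = latticeCast d (i.1.1, 1)) (S : ∀ s : T, Set s.1)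
    (huniq : ∀ z, ∀ s s' : T, z ∈ halfOpenCone (latticeCast d) (b s) (S s) →
      z ∈ halfOpenCone (latticeCast d) (b s') (S s') → s = s')
    {m : ℤ} (hm : 1 ≤ m) (X : Set (Fin d → ℤ))
    (hX : ∀ x, x ∈ X ↔ ∃ s : T, (x, m) ∈ halfOpenCone (latticeCast d) (b s) (S s)) :
    (X.ncard : ℚ) =
      (∑ s : T, conePoly (latticeCast d) (b s) d (AddMonoidHom.snd _ _) (S s)).eval (m : ℚ) := by
  classical
  have hcount : ∀ s : T, _ := fun s =>
    finite_and_ncard_halfOpenCone (d := d) (S := S s) (m := m) (latticeCast d) (b s)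
      (fun i => (i.1.1, 1)) (fun i => (hb s i).symm) (AddMonoidHom.snd _ _) (fun _ => rfl)
      (fun z => by
        have := congrArg Prod.snd ((b s).sum_repr (latticeCast d z))
        simpa [Prod.snd_sum, hb, latticeCast_apply] using this.symm)
      (by
        rw [← Module.finrank_eq_card_basis (b s)]
        simp)
      (finite_halfOpenBox_latticeCast (b s) (S s)) hm
  have himage : (fun x => (x, m)) '' X =
      ⋃ s : T, {z | z ∈ halfOpenCone (latticeCast d) (b s) (S s) ∧
        AddMonoidHom.snd (Fin d → ℤ) ℤ z = m} := by
    ext ⟨x, n⟩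
    simp only [Set.mem_image, Prod.mk.injEq, Set.mem_iUnion,
      Set.mem_ofPred_eq, AddMonoidHom.coe_snd]
    constructor
    · rintro ⟨x, hx, rfl, rfl⟩
      obtain ⟨s, hs⟩ := (hX x).mp hx
      exact ⟨s, hs, rfl⟩
    · rintro ⟨s, hs, rfl⟩
      exact ⟨x, (hX x).mpr ⟨s, hs⟩, rfl, rfl⟩
  rw [← Set.ncard_image_of_injective X (f := fun x => (x, m)) fun x y h => (Prod.ext_iff.mp h).1,
    himage, Set.ncard_iUnion_of_finite fun s => (hcount s).1, finsum_eq_sum_of_fintype,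
    Nat.cast_sum, eval_finsetSum]
  · exact Finset.sum_congr rfl fun s _ => (hcount s).2
  · intro s s' hss
    exact Set.disjoint_left.mpr fun z hz hz' => hss (huniq z s s' hz.1 hz'.1)

/-- The Ehrhart polynomial of a reflexive polytope has degree at most `d` and satisfies the
functional equation `L (-1 - x) = (-1) ^ d * L x`. -/
theorem ehrhart_reflexive {P : Set (Fin d → ℝ)} {L : ℚ[X]} (hP : IsLatticePolytope d P)
    (href : IsReflexive d P) (hL : IsEhrhart d P L) :
    L.natDegree ≤ d ∧ ∀ x : ℚ, L.eval (-1 - x) = (-1) ^ d * L.eval x := by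
  classical
  obtain ⟨U, hU⟩ := exists_mem_smul_iff_facetForm hP href
  obtain ⟨V, rfl⟩ := hP
  set P := convexHull ℝ ((fun v : Fin d → ℤ => fun i => (v i : ℝ)) '' (V : Set (Fin d → ℤ)))
  set w : V → (Fin d → ℝ) × ℝ := fun v => latticeCast d (v.1, 1)
  obtain ⟨T, b, hb, hdec⟩ := exists_halfOpen_decomposition w (LinearMap.snd ℝ _ _)
    (fun v => by simp [w, latticeCast_apply])
  obtain ⟨v, hv, hvU⟩ := exists_isGeneric_facetForm_pos w U
  have : Fintype T := Fintype.ofFinite T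
  let S : ∀ s : T, Set s.1 := fun s => {i | (b s).repr v i < 0}
  have hneg : ∀ (s : T) i, (b s).repr (-v) i < 0 ↔ i ∈ (S s)ᶜ := by
    intro s i
    have := hv.repr_ne_zero (b s) (hb s) i
    simp only [S, map_neg, Finsupp.neg_apply, Set.mem_compl_iff, Set.mem_ofPred_eq, not_lt,
      Left.neg_neg_iff]
    exact ⟨le_of_lt, fun h => lt_of_le_of_ne h this.symm⟩
  have hcone : ∀ (z : (Fin d → ℤ) × ℤ) (g : (Fin d → ℝ) × ℝ), 1 ≤ z.2 →
      ∀ᶠ ε in 𝓝[>] (0 : ℝ), (latticeCast d z + ε • g ∈ coneOf w ↔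
        ∀ u ∈ U, 0 ≤ facetForm u (latticeCast d z) + ε * facetForm u g) := by
    intro z g hz
    have hc : Tendsto (fun ε : ℝ => (z.2 : ℝ) + ε * g.2) (𝓝[>] 0) (𝓝 (z.2 : ℝ)) := by
      have : Continuous fun ε : ℝ => (z.2 : ℝ) + ε * g.2 := by fun_prop
      simpa using (this.tendsto 0).mono_left nhdsWithin_le_nhds
    have hz0 : (0 : ℝ) < z.2 := by exact_mod_cast hz
    filter_upwards [hc.eventually (lt_mem_nhds hz0)] with ε hε
    have heq : latticeCast d z + ε • g =
        ((latticeCast d z + ε • g).1, (z.2 : ℝ) + ε * g.2) := rfl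
    rw [heq, mem_coneOf_iff_mem_smul V _ hε, hU _ _ hε, ← heq]
    simp only [map_add, map_smul, smul_eq_mul]
  have hlat : ∀ (x : Fin d → ℤ) (m : ℕ), 1 ≤ m → (x ∈ latticePts d ((m : ℝ) • P) ↔
      ∀ u ∈ U, 0 ≤ ∑ i, u i * x i + (m : ℤ)) := by
    intro x m hm
    refine (hU _ _ (by exact_mod_cast hm)).trans (forall₂_congr fun u _ => ?_)
    rw [← Int.cast_nonneg_iff (R := ℝ), ← facetForm_latticeCast u (x, (m : ℤ))]
    simp [latticeCast_apply]
  have hclosed : ∀ (x : Fin d → ℤ) (m : ℕ), 1 ≤ m → (x ∈ latticePts d ((m : ℝ) • P) ↔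
      ∃ s : T, (x, (m : ℤ)) ∈ halfOpenCone (latticeCast d) (b s) (S s)) := by
    intro x m hm
    have h1 := (hdec v hv (latticeCast d (x, (m : ℤ)))).1
    have h2 := hcone (x, (m : ℤ)) v (by simpa using hm)
    have h3 := (Filter.eventually_all_finset U).mpr fun u hu =>
      eventually_nonneg_add_mul_iff (r := facetForm u (latticeCast d (x, (m : ℤ)))) (hvU u hu)
    obtain ⟨ε, h1, h2, h3⟩ := (h1.and (h2.and h3)).exists
    refine Iff.trans ?_ h1
    rw [h2, hlat x m hm]
    refine forall₂_congr fun u hu => ?_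
    rw [h3 u hu, facetForm_latticeCast, Int.cast_nonneg_iff]
  have hopen : ∀ (x : Fin d → ℤ) (m : ℕ), 1 ≤ m → (x ∈ latticePts d ((m : ℝ) • P) ↔
      ∃ s : T, (x, (m : ℤ) + 1) ∈ halfOpenCone (latticeCast d) (b s) (S s)ᶜ) := by
    intro x m hm
    have h1 := (hdec (-v) hv.neg (latticeCast d (x, (m : ℤ) + 1))).1
    have h2 := hcone (x, (m : ℤ) + 1) (-v) (by simp)
    have h3 := (Filter.eventually_all_finset U).mpr fun u hu =>
      eventually_nonneg_sub_mul_iff (r := facetForm u (latticeCast d (x, (m : ℤ) + 1))) (hvU u hu)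
    obtain ⟨ε, h1, h2, h3⟩ := (h1.and (h2.and h3)).exists
    simp only [hneg] at h1
    refine Iff.trans ?_ h1
    rw [h2, hlat x m hm]
    refine forall₂_congr fun u hu => ?_
    rw [map_neg, mul_neg, ← sub_eq_add_neg, h3 u hu, facetForm_latticeCast, Int.cast_pos]
    simp only
    omega
  have huniq : ∀ z, ∀ s s' : T, z ∈ halfOpenCone (latticeCast d) (b s) (S s) →
      z ∈ halfOpenCone (latticeCast d) (b s') (S s') → s = s' := fun z s s' =>
    (hdec v hv (latticeCast d z)).2 s s'
  have huniq' : ∀ z, ∀ s s' : T, z ∈ halfOpenCone (latticeCast d) (b s) (S s)ᶜ →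
      z ∈ halfOpenCone (latticeCast d) (b s') (S s')ᶜ → s = s' := fun z s s' => by
    have := (hdec (-v) hv.neg (latticeCast d z)).2 s s'
    simp only [hneg] at this
    exact this
  have hLsum : L = ∑ s : T, conePoly (latticeCast d) (b s) d (AddMonoidHom.snd _ _) (S s) := by
    refine eq_of_infinite_eval_eq _ _ ((Set.infinite_range_of_injective
      (f := fun n : ℕ => ((n + 1 : ℕ) : ℚ)) fun i j h => by simpa using h).mono ?_)
    rintro _ ⟨n, rfl⟩
    exact (hL (n + 1)).trans (ncard_eq_eval_sum_conePoly b hb S huniq (m := ((n + 1 : ℕ) : ℤ))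
      (by simp) _ fun x => hclosed x (n + 1) (by simp))
  refine ⟨?_, ?_⟩
  · rw [hLsum]
    exact natDegree_sum_le_of_forall_le _ _ fun s _ =>
      natDegree_conePoly_le _ _ _ _ (finite_halfOpenBox_latticeCast (b s) (S s))
  · have hrec : ∀ y : ℚ,
        (∑ s : T, conePoly (latticeCast d) (b s) d (AddMonoidHom.snd _ _) (S s)ᶜ).eval y =
          (-1) ^ d * L.eval (-y) := by
      intro y
      rw [hLsum, eval_finsetSum, eval_finsetSum, Finset.mul_sum]
      refine Finset.sum_congr rfl fun s _ => ?_
      exact conePoly_compl_eval (latticeCast d) (b s) (fun i => (i.1.1, 1))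
        (fun i => (hb s i).symm) _ (fun _ => rfl)
        (by
          rw [← Module.finrank_eq_card_basis (b s)]
          simp)
        (finite_halfOpenBox_latticeCast (b s)) y
    have hpoly : L.comp (-1 - X) = C ((-1) ^ d) * L := by
      refine eq_of_infinite_eval_eq _ _ ((Set.infinite_range_of_injective
        (f := fun n : ℕ => ((n + 1 : ℕ) : ℚ)) fun i j h => by simpa using h).mono ?_)
      rintro _ ⟨n, rfl⟩
      have h1 := (hL (n + 1)).trans (ncard_eq_eval_sum_conePoly b hb (fun s => (S s)ᶜ) huniq'
        (m := ((n + 1 : ℕ) : ℤ) + 1) (by omega) _ fun x => hopen x (n + 1) (by simp))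
      rw [hrec] at h1
      simp only [Set.mem_ofPred_eq, eval_comp, eval_sub, eval_neg, eval_one,
        eval_X, eval_mul, eval_C]
      rw [h1, ← mul_assoc, ← mul_pow]
      simp only [mul_neg, mul_one, neg_neg, one_pow, one_mul]
      congr 1
      push_cast
      ring
    intro x
    have := congrArg (eval x) hpoly
    simpa [eval_comp] using this

end Reflexive

/-- A full-dimensional lattice polytope in `ℝ^d` contains at least `d + 1` lattice points. -/
lemma succ_le_ncard_latticePts {d : ℕ} {P : Set (Fin d → ℝ)} (hP : IsLatticePolytope d P)
    (hdim : IsFullDim d P) : d + 1 ≤ (latticePts d P).ncard := by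
  classical
  obtain ⟨V, rfl⟩ := hP
  have hbdd := (((V.finite_toSet.image
    fun v : Fin d → ℤ => fun i => (v i : ℝ)).isCompact_convexHull ℝ).isBounded)
  obtain ⟨C, hC⟩ := hbdd.exists_norm_le
  have hfin : (latticePts d (convexHull ℝ
      ((fun v : Fin d → ℤ => fun i => (v i : ℝ)) '' (V : Set (Fin d → ℤ))))).Finite := by
    refine Set.Finite.of_finite_image (f := fun x => (x, (0 : ℤ)))
      ((finite_norm_latticeCast_le C).subset ?_) fun x _ y _ h => (Prod.ext_iff.mp h).1
    rintro _ ⟨x, hx, rfl⟩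
    have h0 := hC _ hx
    simpa [latticeCast_apply, Prod.norm_def, (norm_nonneg _).trans h0] using h0
  have hsub : (V : Set (Fin d → ℤ)) ⊆ latticePts d (convexHull ℝ
      ((fun v : Fin d → ℤ => fun i => (v i : ℝ)) '' (V : Set (Fin d → ℤ)))) :=
    fun v hv => subset_convexHull ℝ _ ⟨v, hv, rfl⟩
  refine le_trans ?_ (Set.ncard_le_ncard hsub hfin)
  rw [Set.ncard_coe_finset]
  have hspan : affineSpan ℝ (Set.range fun v : V => fun i => ((v.1 i : ℤ) : ℝ)) = ⊤ := by
    rw [IsFullDim, affineSpan_convexHull] at hdim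
    rw [← hdim]
    congr 1
    ext x
    simp
  have hne : Nonempty V := by
    by_contra h
    rw [not_nonempty_iff] at h
    rw [Set.range_eq_empty, AffineSubspace.span_empty] at hspan
    exact AffineSubspace.bot_ne_top ℝ _ _ hspan
  obtain ⟨n, hn⟩ : ∃ n, Fintype.card V = n + 1 :=
    ⟨Fintype.card V - 1, by have := Fintype.card_pos (α := V); omega⟩
  have h1 := finrank_vectorSpan_range_le ℝ (fun v : V => fun i => ((v.1 i : ℤ) : ℝ)) hn
  rw [← direction_affineSpan, hspan, AffineSubspace.direction_top, finrank_top] at h1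
  simp only [Module.finrank_fintype_fun_eq_card, Fintype.card_fin, Fintype.card_coe] at h1 hn
  omega

/-- A polynomial of degree at most five that is antisymmetric about `-1/2` is an odd polynomial in
`X + 1/2`. -/
lemma exists_odd_expansion {L : ℚ[X]} (hdeg : L.natDegree ≤ 5)
    (hsymm : ∀ x : ℚ, L.eval (-1 - x) = (-1) ^ 5 * L.eval x) :
    ∃ p q r : ℚ, ∀ z : ℂ,
      aeval z L = (z + 1 / 2) * (p * ((z + 1 / 2) ^ 2) ^ 2 + q * (z + 1 / 2) ^ 2 + r) := by
  have hlt : L.natDegree < 6 := by omega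
  have h0 := hsymm 0
  have h1 := hsymm 1
  have h2 := hsymm 2
  simp only [eval_eq_sum_range' hlt, Finset.sum_range_succ, Finset.sum_range_zero] at h0 h1 h2
  norm_num at h0 h1 h2
  refine ⟨L.coeff 5, L.coeff 3 - 5 / 2 * L.coeff 5,
    L.coeff 1 - 5 / 16 * L.coeff 5 - 3 / 4 * (L.coeff 3 - 5 / 2 * L.coeff 5), fun z => ?_⟩
  have e4 : L.coeff 4 = 5 / 2 * L.coeff 5 := by linarith
  have e2 : L.coeff 2 = 5 / 4 * L.coeff 5 + 3 / 2 * (L.coeff 3 - 5 / 2 * L.coeff 5) := by linarith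
  have e0 : L.coeff 0 = 1 / 32 * L.coeff 5 + 1 / 8 * (L.coeff 3 - 5 / 2 * L.coeff 5) +
      1 / 2 * (L.coeff 1 - 5 / 16 * L.coeff 5 - 3 / 4 * (L.coeff 3 - 5 / 2 * L.coeff 5)) := by
    linarith
  rw [aeval_eq_sum_range' hlt]
  simp only [Finset.sum_range_succ, Finset.sum_range_zero, Algebra.smul_def, e4, e2, e0,
    eq_ratCast]
  push_cast
  ring

theorem statement15 (P : Set (Fin 5 → ℝ)) (L : Polynomial ℚ) (a b : ℝ)
    (hP : IsLatticePolytope 5 P) (hdim : IsFullDim 5 P) (href : IsReflexive 5 P)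
    (hL : IsEhrhart 5 P L) (ha : a ≠ 0) (hb : b ≠ 0)
    (hroot : ((-(1/2) + a : ℝ) : ℂ) + b * Complex.I ∈ cRoots L) :
    |a| < 3/2 ∧ ∀ z ∈ cRoots L, -(5/2) ≤ z.re ∧ z.re ≤ 3/2 := by
  obtain ⟨hdeg, hsymm⟩ := ehrhart_reflexive hP href hL
  obtain ⟨p, q, r, hpqr⟩ := exists_odd_expansion hdeg hsymm
  have heval : ∀ x : ℚ, L.eval x =
      (x + 1 / 2) * (p * ((x + 1 / 2) ^ 2) ^ 2 + q * (x + 1 / 2) ^ 2 + r) := by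
    intro x
    have := hpqr (x : ℂ)
    rw [← eq_ratCast (algebraMap ℚ ℂ) x, aeval_algebraMap_apply] at this
    simp only [eq_ratCast, coe_aeval_eq_eval] at this
    refine Rat.cast_injective (α := ℂ) ?_
    push_cast
    exact this
  have hL0 : L.eval 0 = 1 := by
    have hne : P.Nonempty := ⟨0, interior_subset href.1⟩
    have h := hL 0
    have hpt : latticePts 5 (((0 : ℕ) : ℝ) • P) = {0} := by
      ext x
      simp [latticePts, Set.zero_smul_set hne, funext_iff]
    rw [hpt, Set.ncard_singleton] at h
    simpa using h
  have hL1 : 6 ≤ L.eval 1 := by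
    have h := hL 1
    have hcard := succ_le_ncard_latticePts hP hdim
    rw [Nat.cast_one, Nat.cast_one, one_smul] at h
    rw [h]
    exact_mod_cast hcard
  rw [heval] at hL0 hL1
  have hL0 : (1 / 2 : ℝ) * (p * (1 / 16) + q * (1 / 4) + r) = 1 := by
    have : (1 / 2 : ℚ) * (p * (1 / 16) + q * (1 / 4) + r) = 1 := by linarith
    have h := congrArg ((↑) : ℚ → ℝ) this
    push_cast at h
    exact h
  have hL1 : (6 : ℝ) ≤ 3 / 2 * (p * (81 / 16) + q * (9 / 4) + r) := by
    have : (6 : ℚ) ≤ 3 / 2 * (p * (81 / 16) + q * (9 / 4) + r) := by linarith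
    have h := (Rat.cast_le (K := ℝ)).mpr this
    push_cast at h
    exact h
  have hzero : ∀ z ∈ cRoots L,
      z + 1 / 2 = 0 ∨ (p : ℂ) * ((z + 1 / 2) ^ 2) ^ 2 + q * (z + 1 / 2) ^ 2 + r = 0 := by
    intro z hz
    have h0 := (mem_roots'.mp hz).2
    rw [IsRoot, eval_map_algebraMap, hpqr] at h0
    exact mul_eq_zero.mp h0
  have hs := (hzero _ hroot).resolve_left fun h => hb (by simpa using congrArg Complex.im h)
  have hsq : (((-(1/2) + a : ℝ) : ℂ) + b * Complex.I + 1 / 2) ^ 2 =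
      ⟨a ^ 2 - b ^ 2, 2 * a * b⟩ := by
    apply Complex.ext
    · simp [pow_two]
    · simp [pow_two]
      ring
  rw [hsq] at hs
  have hre : (p : ℝ) * ((a ^ 2 - b ^ 2) ^ 2 - (2 * a * b) ^ 2) + q * (a ^ 2 - b ^ 2) + r = 0 := by
    have := congrArg Complex.re hs
    simp [pow_two] at this
    linarith
  have him : (q : ℝ) = -2 * (a ^ 2 - b ^ 2) * p := by
    have := congrArg Complex.im hs
    simp [pow_two] at this
    have hab : 2 * a * b ≠ 0 := by positivity
    refine mul_right_cancel₀ hab ?_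
    linarith
  have hr : (r : ℝ) = (a ^ 2 + b ^ 2) ^ 2 * p := by
    rw [him] at hre
    linear_combination hre
  rw [him, hr] at hL0 hL1
  have hp : 0 < (p : ℝ) := by
    by_contra! hp
    have : 0 ≤ (1 / 4 - (a ^ 2 - b ^ 2)) ^ 2 + 4 * a ^ 2 * b ^ 2 := by positivity
    nlinarith
  have hbound : |a| < 3 / 2 := by
    refine lt_of_pow_lt_pow_left₀ 2 (by norm_num) ?_
    rw [sq_abs]
    by_contra! hA
    have hkey : 0 < 2 * ((1 / 4 - (a ^ 2 - b ^ 2)) ^ 2 + 4 * a ^ 2 * b ^ 2) -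
        ((9 / 4 - (a ^ 2 - b ^ 2)) ^ 2 + 4 * a ^ 2 * b ^ 2) := by
      nlinarith [sq_nonneg b, sq_nonneg (b ^ 2), mul_nonneg (sub_nonneg.mpr hA) (sq_nonneg b),
        mul_nonneg (sub_nonneg.mpr hA) (sub_nonneg.mpr hA)]
    nlinarith [mul_pos hp hkey]
  refine ⟨hbound, fun z hz => ?_⟩
  have habs : |(z + 1 / 2).re| ≤ |a| := by
    rcases hzero z hz with h | h
    · rw [h]
      simp
    · generalize z + 1 / 2 = s at h ⊢
      have hfac : (p : ℂ) * ((s - (a + b * Complex.I)) * (s + (a + b * Complex.I)) *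
          ((s - (a - b * Complex.I)) * (s + (a - b * Complex.I)))) = 0 := by
        have hq' : (q : ℂ) = -2 * (a ^ 2 - b ^ 2) * p := by
          exact_mod_cast congrArg ((↑) : ℝ → ℂ) him
        have hr' : (r : ℂ) = (a ^ 2 + b ^ 2) ^ 2 * p := by
          exact_mod_cast congrArg ((↑) : ℝ → ℂ) hr
        rw [hq', hr'] at h
        rw [← h]
        have hI : Complex.I ^ 2 = -1 := Complex.I_sq
        linear_combination (-2 * p * b ^ 2 * s ^ 2 - 2 * p * a ^ 2 * b ^ 2 +
          p * b ^ 4 * (Complex.I ^ 2 - 1)) * hI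
      have hp0 : (p : ℂ) ≠ 0 := by
        have : p ≠ 0 := by rintro rfl; simp at hp
        exact_mod_cast this
      rcases mul_eq_zero.mp ((mul_eq_zero.mp hfac).resolve_left hp0) with h | h <;>
        rcases mul_eq_zero.mp h with h | h
      · simp [sub_eq_zero.mp h]
      · simp [eq_neg_of_add_eq_zero_left h]
      · simp [sub_eq_zero.mp h]
      · simp [eq_neg_of_add_eq_zero_left h]
  have hre2 : (z + 1 / 2).re = z.re + 1 / 2 := by simp
  rw [hre2] at habs
  have := abs_le.mp (habs.trans hbound.le)
  constructor <;> linarith
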